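/- Fix N ≥ 1 and a partition λ = (λ_1 ≥ … ≥ λ_N ≥ 0) with n = |λ|; set d_i = λ_i + N − i and P = {d_1,…,d_N}. Let 𝒪_λ be the polynomial ring over ℂ in the variables f_{ij}, for i = 1,…,N and j = 1,…,d_i with d_i − j ∉ P, and let f_i(u) = u^{d_i} + Σ_{j : d_i−j∉P} f_{ij} u^{d_i−j} ∈ 𝒪_λ[u]. Define Σ_1,…,Σ_n ∈ 𝒪_λ by Wr(f_1(u),…,f_N(u)) = ∏_{1≤i<j≤N}(d_j−d_i) · (u^n + Σ_{s=1}^n (−1)^s Σ_s u^{n−s}). For a = (a_1,…,a_n) ∈ ℂ^n let I_{λ,a} ⊂ 𝒪_λ be the ideal generated by Σ_s − a_s, s = 1,…,n, and let 𝒪_{λ,a} = 𝒪_λ/I_{λ,a}. Then for every a ∈ ℂ^n: (i) 𝒪_{λ,a} is finite-dimensional over ℂ; (ii) 𝒪_{λ,a} admits a nondegenerate symmetric invariant bilinear form (is a Frobenius algebra); and (iii) dim_ℂ 𝒪_{λ,a} is the same for all a ∈ ℂ^n. -/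

import Mathlib

/-- The index set of the coordinates f_{ij} on the Schubert cell Ω_{λ̄}(∞):
pairs (i, j) with 1 ≤ j ≤ d_i and d_i − j ∉ P = {d₁,…,d_N}. -/
def SchubertVar (N : ℕ) (d : Fin N → ℕ) : Type :=
  {p : Fin N × ℕ // 1 ≤ p.2 ∧ p.2 ≤ d p.1 ∧ d p.1 - p.2 ∉ Set.range d}

/-- The algebra 𝒪_λ of regular functions on the Schubert cell: the polynomial ring in
the variables f_{ij}. -/
abbrev SchubertAlg (N : ℕ) (d : Fin N → ℕ) : Type :=
  MvPolynomial (SchubertVar N d) ℂ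

/-- The generating function f_i(u) = u^{d_i} + Σ_{j : d_i−j ∉ P, 1 ≤ j ≤ d_i}
f_{ij} u^{d_i−j}, a polynomial in u with coefficients in 𝒪_λ. -/
noncomputable def genFun (N : ℕ) (d : Fin N → ℕ) (i : Fin N) :
    Polynomial (SchubertAlg N d) :=
  Polynomial.X ^ (d i) +
    ∑ j ∈ Finset.Icc 1 (d i),
      if h : 1 ≤ j ∧ j ≤ d i ∧ d i - j ∉ Set.range d then
        Polynomial.C (MvPolynomial.X (⟨(i, j), h⟩ : SchubertVar N d)) *
          Polynomial.X ^ (d i - j)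
      else 0

/-- The Wronskian of N polynomials over a commutative ring: the determinant of the N×N
matrix whose (i,j) entry is the (j−1)-st derivative of the i-th polynomial. -/
noncomputable def wronR {R : Type*} [CommRing R] (N : ℕ) (f : Fin N → Polynomial R) :
    Polynomial R :=
  (Matrix.of fun i j : Fin N => (Polynomial.derivative^[(j : ℕ)] (f i))).det

/-- The elements Σ_s ∈ 𝒪_λ, defined by
Wr(f₁(u),…,f_N(u)) = ∏_{i<j}(d_j−d_i) · (uⁿ + Σ_{s=1}^n (−1)^s Σ_s u^{n−s});
i.e. Σ_s is (−1)^s/∏_{i<j}(d_j−d_i) times the coefficient of u^{n−s} in the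
Wronskian of the generating functions. -/
noncomputable def SigmaEl (N : ℕ) (d : Fin N → ℕ) (n : ℕ) (s : ℕ) : SchubertAlg N d :=
  (((-1 : ℂ) ^ s) * (∏ i : Fin N, ∏ j ∈ Finset.Ioi i, ((d j : ℂ) - (d i : ℂ)))⁻¹) •
    ((wronR N (genFun N d)).coeff (n - s))

/-- The ideal I_{λ,a} ⊂ 𝒪_λ generated by Σ_s − a_s, s = 1,…,n; the quotient
𝒪_{λ,a} = 𝒪_λ/I_{λ,a} is the scheme-theoretic fiber of the Wronski map. -/
noncomputable def wronskiIdeal (N : ℕ) (d : Fin N → ℕ) (n : ℕ) (a : Fin n → ℂ) :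
    Ideal (SchubertAlg N d) :=
  Ideal.span (Set.range fun s : Fin n =>
    SigmaEl N d n ((s : ℕ) + 1) - MvPolynomial.C (a s))

open MvPolynomial in
theorem aux_syz {σ S : Type*} [Fintype σ] [DecidableEq σ] [CommRing S]
    (δ C' : σ → MvPolynomial σ S) (J : Ideal (MvPolynomial σ S))
    (hC : ∀ a b, X a * C' b - X b * C' a ∈ J) (hδ : ∑ k, δ k * X k = 0) :
    ∑ k, δ k * C' k ∈ J := by
  classical
  let Γ : (σ →₀ ℕ) → MvPolynomial σ S ⧸ J := fun m =>
    if h : ∃ k, m k ≠ 0 then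
      Ideal.Quotient.mk J (monomial (m - Finsupp.single h.choose 1) 1 * C' h.choose) else 0
  have key : ∀ (m : σ →₀ ℕ) (k : σ),
      Γ (m + Finsupp.single k 1) = Ideal.Quotient.mk J (monomial m 1 * C' k) := by
    intro m k
    have h : ∃ l, (m + Finsupp.single k 1 : σ →₀ ℕ) l ≠ 0 := ⟨k, by simp⟩
    have hΓ : Γ (m + Finsupp.single k 1) = Ideal.Quotient.mk J (monomial (m + Finsupp.single k 1 - Finsupp.single h.choose 1) 1 * C' h.choose) := dif_pos h
    rw [hΓ]
    have hl := h.choose_spec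
    generalize h.choose = l at hl
    by_cases hkl : l = k
    · subst hkl; simp
    · have hm : m l ≠ 0 := by simpa [Finsupp.single_apply, Ne.symm hkl] using hl
      obtain ⟨m', rfl⟩ : ∃ m', m = m' + Finsupp.single l 1 := by
        refine ⟨m - Finsupp.single l 1, ?_⟩
        rw [tsub_add_cancel_of_le]
        simpa using Nat.one_le_iff_ne_zero.mpr hm
      rw [add_right_comm, add_tsub_cancel_right, Ideal.Quotient.eq]
      have e : ∀ a : σ, monomial (m' + Finsupp.single a 1) (1 : S) = monomial m' 1 * X a := by
        intro a; rw [X, monomial_mul, mul_one]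
      rw [e, e, mul_assoc, mul_assoc, ← mul_sub]
      exact J.mul_mem_left _ (hC _ _)
  let Φ : MvPolynomial σ S →ₗ[S] MvPolynomial σ S ⧸ J := (basisMonomials σ S).constr S Γ
  have hΦ : ∀ (k : σ) (g : MvPolynomial σ S), Φ (g * X k) = Ideal.Quotient.mk J (g * C' k) := by
    intro k g
    induction g using MvPolynomial.induction_on' with
    | monomial u a =>
      have e1 : monomial u a * X k = a • monomial (u + Finsupp.single k 1) (1 : S) := by
        rw [X, monomial_mul, smul_monomial, smul_eq_mul]
      have e2 : monomial u a * C' k = a • (monomial u (1 : S) * C' k) := by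
        rw [← smul_mul_assoc, smul_monomial, smul_eq_mul, mul_one]
      have e3 : Φ (monomial (u + Finsupp.single k 1) (1 : S)) = Γ (u + Finsupp.single k 1) := by
        have := (basisMonomials σ S).constr_basis S Γ (u + Finsupp.single k 1)
        rwa [coe_basisMonomials] at this
      rw [e1, e2, map_smul, e3, key]; rfl
    | add p q hp hq => rw [add_mul, add_mul, map_add, map_add, hp, hq]
  have : Φ (∑ k, δ k * X k) = Ideal.Quotient.mk J (∑ k, δ k * C' k) := by
    rw [map_sum, map_sum]; exact Finset.sum_congr rfl fun k _ => hΦ _ _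
  rw [hδ, map_zero] at this
  exact Ideal.Quotient.eq_zero_iff_mem.mp this.symm

theorem aux_cof {σ T : Type*} [Fintype σ] [DecidableEq σ] [CommRing T]
    (W : Matrix σ σ T) (z p : σ → T) (i : σ) (hW : ∀ k, k ≠ i → W.mulVec z k = p k) (a b : σ) :
    z a * W.adjugate b i - z b * W.adjugate a i ∈ Ideal.span (Set.range p) := by
  have h := congrFun (congrArg (fun M : Matrix σ σ T => M.mulVec z)
    (Matrix.adjugate_mul (W.updateRow i (Pi.single b 1)))) a
  simp only [← Matrix.mulVec_mulVec, Matrix.smul_mulVec, Matrix.one_mulVec, Pi.smul_apply, smul_eq_mul] at h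
  rw [← Matrix.adjugate_apply] at h
  rw [Matrix.mulVec, dotProduct, ← Finset.add_sum_erase _ _ (Finset.mem_univ i)] at h
  have h1 : (W.updateRow i (Pi.single b 1)).adjugate a i = W.adjugate a i := by
    rw [Matrix.adjugate_apply, Matrix.adjugate_apply, Matrix.updateRow_idem]
  have h2 : (W.updateRow i (Pi.single b 1)).mulVec z i = z b := by
    simp [Matrix.mulVec, dotProduct, Pi.single_apply]
  rw [h1, h2] at h
  have h3 : z a * W.adjugate b i - z b * W.adjugate a i = 
    ∑ x ∈ Finset.univ.erase i, (W.updateRow i (Pi.single b 1)).adjugate a x * (W.updateRow i (Pi.single b 1)).mulVec z x := by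
    rw [mul_comm (z a), ← h]; ring
  rw [h3]
  refine Ideal.sum_mem _ fun k hk => Ideal.mul_mem_left _ _ ?_
  have hk' : k ≠ i := Finset.ne_of_mem_erase hk
  have : (W.updateRow i (Pi.single b 1)).mulVec z k = p k := by
    rw [← hW k hk']; simp [Matrix.mulVec, Matrix.updateRow_ne hk']
  rw [this]
  exact Ideal.subset_span ⟨k, rfl⟩

open MvPolynomial in
theorem aux_det {σ S : Type*} [Fintype σ] [DecidableEq σ] [CommRing S]
    (U V : Matrix σ σ (MvPolynomial σ S)) (p : σ → MvPolynomial σ S)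
    (hU : U.mulVec X = p) (hV : V.mulVec X = p) :
    U.det - V.det ∈ Ideal.span (Set.range p) := by
  classical
  let W : Finset σ → Matrix σ σ (MvPolynomial σ S) := fun s =>
    Matrix.of fun i => if i ∈ s then U i else V i
  have hWz : ∀ s, (W s).mulVec X = p := by
    intro s; ext1 k
    by_cases h : k ∈ s
    · rw [← hU]; simp [W, Matrix.mulVec, h]
    · rw [← hV]; simp [W, Matrix.mulVec, h]
  suffices H : ∀ s, (W s).det - V.det ∈ Ideal.span (Set.range p) by
    have := H Finset.univ
    have e : W Finset.univ = U := by ext1; simp [W]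
    rwa [e] at this
  intro s
  induction s using Finset.induction_on with
  | empty =>
    have e : W ∅ = V := by ext1; simp [W]
    rw [e, sub_self]; exact Ideal.zero_mem _
  | insert i s hi ih =>
    have e1 : W (insert i s) = (W s).updateRow i (V i + (U i - V i)) := by
      ext1 k
      by_cases h : k = i
      · subst h; simp [W]
      · simp [W, h]
    have e2 : (W s).updateRow i (V i) = W s := by
      ext1 k
      by_cases h : k = i
      · subst h; simp [W, hi]
      · simp [h]
    rw [e1, Matrix.det_updateRow_add, e2, add_sub_right_comm]
    refine Ideal.add_mem _ ih ?_
    have e3 : ((W s).updateRow i (U i - V i)).det = ∑ k, (U i - V i) k * (W s).adjugate k i := by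
      rw [← Matrix.cramer_transpose_apply, Matrix.cramer_eq_adjugate_mulVec, Matrix.mulVec, dotProduct]
      refine Finset.sum_congr rfl fun k _ => ?_
      rw [mul_comm, ← Matrix.adjugate_transpose, Matrix.transpose_apply]
    rw [e3]
    apply aux_syz
    · intro a b
      exact aux_cof (W s) X p i (fun k _ => congrFun (hWz s) k) a b
    · have h1 := congrFun hU i
      have h2 := congrFun hV i
      simp only [Matrix.mulVec, dotProduct] at h1 h2
      simp only [Pi.sub_apply, sub_mul, Finset.sum_sub_distrib, h1, h2, sub_self]


noncomputable def tauF {σ R : Type*} [Fintype σ] [CommRing R] (c : σ → ℕ → R) :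
    MvPolynomial σ R →ₗ[R] R :=
  (MvPolynomial.basisMonomials σ R).constr R (fun m => ∏ i, c i (m i))

theorem tauF_monomial {σ R : Type*} [Fintype σ] [CommRing R] (c : σ → ℕ → R) (m : σ →₀ ℕ) (a : R) :
    tauF c (MvPolynomial.monomial m a) = a * ∏ i, c i (m i) := by
  have h := (MvPolynomial.basisMonomials σ R).constr_basis R (fun m => ∏ i, c i (m i)) m
  rw [MvPolynomial.coe_basisMonomials] at h
  have e : MvPolynomial.monomial m a = a • MvPolynomial.monomial m (1 : R) := by
    rw [MvPolynomial.smul_monomial, smul_eq_mul, mul_one]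
  rw [e, map_smul, smul_eq_mul, tauF, h]

noncomputable def ellF {R : Type*} [CommRing R] (c : ℕ → R) : Polynomial R →ₗ[R] R :=
  (Polynomial.basisMonomials R).constr R c

theorem ellF_monomial {R : Type*} [CommRing R] (c : ℕ → R) (m : ℕ) (a : R) :
    ellF c (Polynomial.monomial m a) = a * c m := by
  have h := (Polynomial.basisMonomials R).constr_basis R c m
  rw [Polynomial.coe_basisMonomials] at h
  have e : Polynomial.monomial m a = a • Polynomial.monomial m (1 : R) := by
    rw [Polynomial.smul_monomial, smul_eq_mul, mul_one]
  rw [e, map_smul, smul_eq_mul, ellF, h]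

theorem ellF_eq {R : Type*} [CommRing R] (c : ℕ → R) (g : Polynomial R) :
    ellF c g = ∑ k ∈ g.support, g.coeff k * c k := by
  conv_lhs => rw [g.as_sum_support, map_sum]
  exact Finset.sum_congr rfl fun k _ => ellF_monomial _ _ _

theorem tauF_prod {σ R : Type*} [Fintype σ] [CommRing R] (c : σ → ℕ → R)
    (g : σ → Polynomial R) :
    tauF c (∏ i, Polynomial.aeval (MvPolynomial.X i : MvPolynomial σ R) (g i)) =
      ∏ i, ellF (c i) (g i) := by
  classical
  have h1 : ∀ i, Polynomial.aeval (MvPolynomial.X i : MvPolynomial σ R) (g i) =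
      ∑ k ∈ (g i).support, MvPolynomial.monomial (Finsupp.single i k) ((g i).coeff k) := by
    intro i
    rw [Polynomial.aeval_eq_sum_range' (lt_add_one _), Finset.sum_subset
      (Polynomial.supp_subset_range (lt_add_one (g i).natDegree))]
    · refine Finset.sum_congr rfl fun k _ => ?_
      rw [MvPolynomial.X_pow_eq_monomial, MvPolynomial.smul_monomial, smul_eq_mul, mul_one]
    · intro k _ hk
      rw [Polynomial.notMem_support_iff.mp hk, map_zero]
  simp_rw [h1, ellF_eq, Finset.prod_univ_sum, map_sum]
  refine Finset.sum_congr rfl fun p _ => ?_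
  have h2 : ∀ s : Finset σ, ∏ i ∈ s, MvPolynomial.monomial (Finsupp.single i (p i)) ((g i).coeff (p i)) =
      MvPolynomial.monomial (∑ i ∈ s, Finsupp.single i (p i)) (∏ i ∈ s, (g i).coeff (p i)) := by
    intro s
    induction s using Finset.induction_on with
    | empty => simp
    | insert i s hi ih =>
      rw [Finset.prod_insert hi, Finset.sum_insert hi, Finset.prod_insert hi, ih,
        MvPolynomial.monomial_mul]
  rw [h2, tauF_monomial, ← Finset.prod_mul_distrib]
  refine Finset.prod_congr rfl fun i _ => ?_
  congr 2
  rw [Finsupp.finsetSum_apply]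
  simp [Finsupp.single_apply]

theorem tauF_map {σ R S : Type*} [Fintype σ] [CommRing R] [CommRing S] [Algebra R S]
    (c : σ → ℕ → R) (g : MvPolynomial σ R) :
    tauF (fun i k => algebraMap R S (c i k)) (MvPolynomial.map (algebraMap R S) g) =
      algebraMap R S (tauF c g) := by
  induction g using MvPolynomial.induction_on' with
  | monomial u a => rw [MvPolynomial.map_monomial, tauF_monomial, tauF_monomial, map_mul, map_prod]
  | add p q hp hq => rw [map_add, map_add, map_add, map_add, hp, hq]

theorem ellF_map {R S : Type*} [CommRing R] [CommRing S] [Algebra R S]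
    (c : ℕ → R) (g : Polynomial R) :
    ellF (fun k => algebraMap R S (c k)) (g.map (algebraMap R S)) =
      algebraMap R S (ellF c g) := by
  induction g using Polynomial.induction_on' with
  | monomial u a => rw [Polynomial.map_monomial, ellF_monomial, ellF_monomial, map_mul]
  | add p q hp hq => rw [Polynomial.map_add, map_add, map_add, map_add, hp, hq]

theorem exists_ell {R : Type*} [CommRing R] (P : Polynomial R) (hP : P.Monic)
    (d : ℕ) (hd : P.natDegree = d + 1) :
    ∃ c : ℕ → R, (∀ k < d, c k = 0) ∧ c d = 1 ∧ ∀ g, ellF c (P * g) = 0 := by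
  nontriviality R
  let c : ℕ → R := fun k => (Polynomial.X ^ k %ₘ P).coeff d
  have hc : ∀ k < d + 1, c k = if d = k then 1 else 0 := by
    intro k hk
    have : Polynomial.X ^ k %ₘ P = Polynomial.X ^ k := by
      rw [Polynomial.modByMonic_eq_self_iff hP, Polynomial.degree_X_pow,
        Polynomial.degree_eq_natDegree hP.ne_zero, hd]
      exact_mod_cast hk
    simp only [c, this, Polynomial.coeff_X_pow]
  refine ⟨c, fun k hk => ?_, ?_, ?_⟩
  · rw [hc k (by omega), if_neg (by omega)]
  · rw [hc d (by omega), if_pos rfl]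
  · have h : ∀ g, ellF c g = (g %ₘ P).coeff d := by
      intro g
      induction g using Polynomial.induction_on' with
      | monomial u a =>
        rw [ellF_monomial, ← mul_one a, ← smul_eq_mul a 1, ← Polynomial.smul_monomial,
          Polynomial.smul_modByMonic, Polynomial.coeff_smul, Polynomial.monomial_one_right_eq_X_pow]
        simp [c]
      | add p q hp hq => rw [map_add, hp, hq, Polynomial.add_modByMonic, Polynomial.coeff_add]
    intro g
    rw [h, mul_comm, Polynomial.mul_self_modByMonic hP, Polynomial.coeff_zero]

theorem ell_monic {R : Type*} [CommRing R] (q : Polynomial R) (hq : q.Monic)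
    (d : ℕ) (hd : q.natDegree = d) (c : ℕ → R) (h0 : ∀ k < d, c k = 0) (h1 : c d = 1) :
    ellF c q = 1 := by
  nontriviality R
  rw [ellF_eq, Finset.sum_eq_single d]
  · rw [h1, mul_one, ← hd]; exact hq
  · intro k hk hkd
    have : k ≤ d := hd ▸ Polynomial.le_natDegree_of_mem_supp k hk
    rw [h0 k (by omega), mul_zero]
  · intro h
    rw [Polynomial.notMem_support_iff.mp h, zero_mul]

open MvPolynomial in
theorem aux_det_shift {σ S : Type*} [Fintype σ] [DecidableEq σ] [CommRing S] (x : σ → S)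
    (U V : Matrix σ σ (MvPolynomial σ S)) (p : σ → MvPolynomial σ S)
    (hU : U.mulVec (fun k => X k - C (x k)) = p) (hV : V.mulVec (fun k => X k - C (x k)) = p) :
    U.det - V.det ∈ Ideal.span (Set.range p) := by
  let e : MvPolynomial σ S →ₐ[S] MvPolynomial σ S := aeval (fun k => X k + C (x k))
  let e' : MvPolynomial σ S →ₐ[S] MvPolynomial σ S := aeval (fun k => X k - C (x k))
  have hee : ∀ g, e' (e g) = g := by
    intro g
    have : e'.comp e = AlgHom.id S _ := by
      ext k
      simp [e, e']
    exact congrArg (fun f : MvPolynomial σ S →ₐ[S] MvPolynomial σ S => f g) this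
  have hz : ∀ k, e (X k - C (x k)) = X k := by intro k; simp [e]
  have h : ∀ W : Matrix σ σ (MvPolynomial σ S), W.mulVec (fun k => X k - C (x k)) = p →
      (e.toRingHom.mapMatrix W).mulVec X = fun k => e (p k) := by
    intro W hW; ext1 k
    rw [← hW]
    simp only [Matrix.mulVec, dotProduct, map_sum, map_mul, hz]
    rfl
  have := aux_det _ _ _ (h U hU) (h V hV)
  rw [← RingHom.map_det, ← RingHom.map_det, ← map_sub] at this
  have h2 := Ideal.mem_map_of_mem e'.toRingHom this
  rw [Ideal.map_span, ← Set.range_comp] at h2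
  have h3 : (e'.toRingHom ∘ fun k => e (p k)) = p := by ext1 k; exact hee _
  rw [h3] at h2
  have h4 : e'.toRingHom (e.toRingHom (U.det - V.det)) = U.det - V.det := hee _
  rwa [h4] at h2

open MvPolynomial in
theorem aux_sub_eval {σ S : Type*} [CommRing S] (x : σ → S) (g : MvPolynomial σ S) :
    g - C (eval x g) ∈ Ideal.span (Set.range fun k => (X k - C (x k) : MvPolynomial σ S)) := by
  rw [← Ideal.Quotient.eq_zero_iff_mem]
  set I := Ideal.span (Set.range fun k => (X k - C (x k) : MvPolynomial σ S))
  have : Ideal.Quotient.mk I = (Ideal.Quotient.mk I).comp (C.comp (eval x)) := by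
    apply MvPolynomial.ringHom_ext
    · intro r; simp
    · intro k
      simp only [RingHom.comp_apply, eval_X]
      rw [Ideal.Quotient.eq]
      exact Ideal.subset_span ⟨k, rfl⟩
  rw [map_sub, sub_eq_zero]
  exact congrArg (fun f : MvPolynomial σ S →+* _ => f g) this


open MvPolynomial in
theorem tauF_ideal {σ S : Type*} [Fintype σ] [CommRing S] (c : σ → ℕ → S) (P : σ → Polynomial S)
    (hc : ∀ i k, ellF (c i) (P i * Polynomial.X ^ k) = 0) :
    ∀ g ∈ Ideal.span (Set.range fun i => Polynomial.aeval (X i : MvPolynomial σ S) (P i)),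
      tauF c g = 0 := by
  classical
  intro g hg
  obtain ⟨w, rfl⟩ := Ideal.mem_span_range_iff_exists_fun.mp hg
  rw [map_sum]
  refine Finset.sum_eq_zero fun i _ => ?_
  induction w i using MvPolynomial.induction_on' with
  | monomial u a =>
    let G : σ → Polynomial S := fun j =>
      if j = i then P i * Polynomial.X ^ (u j) else Polynomial.X ^ (u j)
    have e : monomial u a * Polynomial.aeval (X i : MvPolynomial σ S) (P i) =
        a • ∏ j, Polynomial.aeval (X j : MvPolynomial σ S) (G j) := by
      rw [← Finset.mul_prod_erase _ _ (Finset.mem_univ i)]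
      have e1 : ∀ j ∈ Finset.univ.erase i,
          Polynomial.aeval (X j : MvPolynomial σ S) (G j) = X j ^ u j := by
        intro j hj
        simp [G, Finset.ne_of_mem_erase hj]
      rw [Finset.prod_congr rfl e1]
      have e2 : Polynomial.aeval (X i : MvPolynomial σ S) (G i) =
        Polynomial.aeval (X i) (P i) * X i ^ u i := by
        simp only [G, if_true, map_mul, map_pow, Polynomial.aeval_X]
      rw [e2, mul_assoc, Finset.mul_prod_erase _ (fun j => (X j : MvPolynomial σ S) ^ u j)
        (Finset.mem_univ i)]
      rw [monomial_eq, Finsupp.prod_fintype _ _ (by simp), MvPolynomial.smul_eq_C_mul]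
      ring
    rw [e, map_smul, tauF_prod, Finset.prod_eq_zero (Finset.mem_univ i), smul_zero]
    simp only [G, if_true]
    exact hc i _
  | add p q hp hq => rw [add_mul, map_add, hp, hq, add_zero]

open MvPolynomial in
theorem core {σ R S : Type*} [Fintype σ] [CommRing R] [Nontrivial R] [CommRing S] [Algebra R S]
    (π : MvPolynomial σ R →ₐ[R] S) (hπ : Function.Surjective π) (F : σ → MvPolynomial σ R)
    (hker : RingHom.ker π = Ideal.span (Set.range F)) (hint : ∀ i, IsIntegral R (π (X i))) :
    ∃ (lam : S →ₗ[R] R) (s : Finset (σ →₀ ℕ)) (a b : (σ →₀ ℕ) → S),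
      ∀ x, x = ∑ i ∈ s, lam (b i * x) • a i := by
  classical
  let x : σ → S := fun i => π (X i)
  -- monic polynomials
  have hP0 : ∀ i, ∃ (P : Polynomial R) (d : ℕ), P.Monic ∧ P.natDegree = d + 1 ∧
      Polynomial.aeval (x i) P = 0 := by
    intro i
    obtain ⟨P, hP, hP'⟩ := hint i
    refine ⟨Polynomial.X * P, P.natDegree, Polynomial.monic_X.mul hP, ?_, ?_⟩
    · rw [Polynomial.monic_X.natDegree_mul hP, Polynomial.natDegree_X, add_comm]
    · have : Polynomial.aeval (x i) P = 0 := hP'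
      rw [map_mul, this, mul_zero]
  choose P d hPm hPd hPx using hP0
  let Pm : σ → MvPolynomial σ R := fun i => Polynomial.aeval (X i) (P i)
  have hPmker : ∀ i, Pm i ∈ Ideal.span (Set.range F) := by
    intro i
    rw [← hker, RingHom.mem_ker]
    change π (Polynomial.aeval (X i) (P i)) = 0
    rw [← Polynomial.aeval_algHom_apply]; exact hPx i
  have hM : ∀ i, ∃ c : σ → MvPolynomial σ R, ∑ j, c j * F j = Pm i := fun i =>
    Ideal.mem_span_range_iff_exists_fun.mp (hPmker i)
  choose M hM using hM
  let MM : Matrix σ σ (MvPolynomial σ R) := Matrix.of M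
  let α := MM.det
  have hαF : ∀ j, α * F j ∈ Ideal.span (Set.range Pm) := by
    intro j
    have h1 : MM.mulVec F = Pm := by ext1 i; exact hM i
    have h2 : α * F j = (MM.adjugate.mulVec Pm) j := by
      rw [← h1, Matrix.mulVec_mulVec, Matrix.adjugate_mul, Matrix.smul_mulVec, Matrix.one_mulVec]
      rfl
    rw [h2]
    exact Ideal.sum_mem _ fun k _ => Ideal.mul_mem_left _ _ (Ideal.subset_span ⟨k, rfl⟩)
  -- functional
  choose c hc0 hc1 hcP using fun i => exists_ell (P i) (hPm i) (d i) (hPd i)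
  let c' : σ → ℕ → S := fun i k => algebraMap R S (c i k)
  let τ := tauF c
  let τ' := tauF c'
  let mp : MvPolynomial σ R →+* MvPolynomial σ S := MvPolynomial.map (algebraMap R S)
  have hττ : ∀ g, τ' (mp g) = algebraMap R S (τ g) := fun g => tauF_map c g
  have hmpP : ∀ i, mp (Pm i) = Polynomial.aeval (X i) ((P i).map (algebraMap R S)) := by
    intro i
    simp only [mp, Pm]
    rw [Polynomial.aeval_map_algebraMap]
    have : (MvPolynomial.map (algebraMap R S) : MvPolynomial σ R →+* _) =
      (MvPolynomial.mapAlgHom (Algebra.ofId R S) : MvPolynomial σ R →ₐ[R] MvPolynomial σ S).toRingHom := rfl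
    rw [this]
    change (MvPolynomial.mapAlgHom (Algebra.ofId R S) : MvPolynomial σ R →ₐ[R] MvPolynomial σ S) _ = _
    rw [← Polynomial.aeval_algHom_apply]
    simp
  have hτ'P : ∀ g ∈ Ideal.span (Set.range fun i => mp (Pm i)), τ' g = 0 := by
    simp only [hmpP]
    apply tauF_ideal
    intro i k
    have : ellF (c' i) ((P i * Polynomial.X ^ k).map (algebraMap R S)) = 0 := by
      rw [ellF_map, hcP, map_zero]
    simpa using this
  have hτP : ∀ g ∈ Ideal.span (Set.range Pm), τ g = 0 :=
    tauF_ideal c P fun i k => hcP i _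
  -- θ
  have hev : ∀ g, eval x (mp g) = π g := by
    intro g
    rw [eval_map]
    have : π = aeval x := by ext i; simp [x]
    rw [this]; rfl
  have hθ : ∀ j, ∃ t : σ → MvPolynomial σ S, ∑ k, t k * (X k - C (x k)) = mp (F j) := by
    intro j
    apply Ideal.mem_span_range_iff_exists_fun.mp
    have h := aux_sub_eval x (mp (F j))
    have h0 : π (F j) = 0 := by
      rw [← RingHom.mem_ker, hker]; exact Ideal.subset_span ⟨j, rfl⟩
    rwa [hev, h0, map_zero, sub_zero] at h
  choose θ hθ using hθ
  let TT : Matrix σ σ (MvPolynomial σ S) := Matrix.of θ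
  -- q
  have hq : ∀ i, ∃ q : Polynomial S, (P i).map (algebraMap R S) = q * (Polynomial.X - Polynomial.C (x i)) ∧ ellF (c' i) q = 1 := by
    intro i
    nontriviality S
    have hroot : ((P i).map (algebraMap R S)).IsRoot (x i) := by
      rw [Polynomial.IsRoot, Polynomial.eval_map_algebraMap]; exact hPx i
    have hmul := Polynomial.mul_divByMonic_eq_iff_isRoot.mpr hroot
    set q := (P i).map (algebraMap R S) /ₘ (Polynomial.X - Polynomial.C (x i)) with hqdef
    have hdeg : ((P i).map (algebraMap R S)).natDegree = d i + 1 := by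
      rw [(hPm i).natDegree_map, hPd]
    have hqm : q.Monic := by
      refine Polynomial.Monic.of_mul_monic_left (Polynomial.monic_X_sub_C (x i)) ?_
      rw [hmul]; exact (hPm i).map _
    refine ⟨q, by rw [mul_comm, hmul], ell_monic q hqm (d i) ?_ _ ?_ ?_⟩
    · rw [hqdef, Polynomial.natDegree_divByMonic _ (Polynomial.monic_X_sub_C _), hdeg, Polynomial.natDegree_X_sub_C]; rfl
    · intro k hk; simp only [c', hc0 i k hk, map_zero]
    · simp only [c', hc1 i, map_one]
  choose q hq hq1 using hq
  let Q : MvPolynomial σ S := ∏ i, Polynomial.aeval (X i : MvPolynomial σ S) (q i)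
  have hτQ : τ' Q = 1 := by
    simp only [τ', Q]
    rw [tauF_prod]
    exact Finset.prod_eq_one fun i _ => hq1 i
  have hqP : ∀ i, Polynomial.aeval (X i : MvPolynomial σ S) (q i) * (X i - C (x i)) = mp (Pm i) := by
    intro i
    rw [hmpP, hq, map_mul, map_sub, Polynomial.aeval_X, Polynomial.aeval_C]; rfl
  have hQg : ∀ g : MvPolynomial σ S, τ' (Q * g) = eval x g := by
    intro g
    have h1 : Q * (g - C (eval x g)) ∈ Ideal.span (Set.range fun i => mp (Pm i)) := by
      obtain ⟨w, hw⟩ := Ideal.mem_span_range_iff_exists_fun.mp (aux_sub_eval x g)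
      rw [← hw, Finset.mul_sum]
      refine Ideal.sum_mem _ fun k _ => ?_
      have : Q * (w k * (X k - C (x k))) =
        (w k * ∏ i ∈ Finset.univ.erase k, Polynomial.aeval (X i : MvPolynomial σ S) (q i)) * mp (Pm k) := by
        rw [← hqP]
        simp only [Q]
        rw [← Finset.mul_prod_erase _ _ (Finset.mem_univ k)]
        ring
      rw [this]
      exact Ideal.mul_mem_left _ _ (Ideal.subset_span ⟨k, rfl⟩)
    have h2 := hτ'P _ h1
    rw [mul_sub, map_sub, sub_eq_zero] at h2
    rw [h2, mul_comm, ← MvPolynomial.smul_eq_C_mul, map_smul, hτQ, smul_eq_mul, mul_one]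
  -- determinant comparison
  have hdet : mp α * TT.det - Q ∈ Ideal.span (Set.range fun i => mp (Pm i)) := by
    have h := aux_det_shift x (mp.mapMatrix MM * TT)
      (Matrix.diagonal fun i => Polynomial.aeval (X i : MvPolynomial σ S) (q i)) (fun i => mp (Pm i)) ?_ ?_
    · rwa [Matrix.det_mul, ← RingHom.map_det, Matrix.det_diagonal] at h
    · rw [← Matrix.mulVec_mulVec]
      have : TT.mulVec (fun k => X k - C (x k)) = fun j => mp (F j) := by
        ext1 j; exact hθ j
      rw [this]
      ext1 i
      rw [← hM i, map_sum]
      simp only [map_mul]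
      rfl
    · ext1 i
      rw [Matrix.mulVec_diagonal, hqP]
  -- λ
  let lam0 : MvPolynomial σ R →ₗ[R] R := τ ∘ₗ LinearMap.mulLeft R α
  have hlam0 : LinearMap.ker π.toLinearMap ≤ LinearMap.ker lam0 := by
    intro g hg
    have hg' : g ∈ Ideal.span (Set.range F) := by
      rw [← hker]; exact hg
    obtain ⟨w, rfl⟩ := Ideal.mem_span_range_iff_exists_fun.mp hg'
    rw [LinearMap.mem_ker]
    change τ (α * _) = 0
    apply hτP
    rw [Finset.mul_sum]
    refine Ideal.sum_mem _ fun k _ => ?_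
    rw [mul_left_comm]
    exact Ideal.mul_mem_left _ _ (hαF k)
  obtain ⟨lam, hlam⟩ : ∃ lam : S →ₗ[R] R, ∀ g, lam (π g) = τ (α * g) := by
    refine ⟨(LinearMap.ker π.toLinearMap).liftQ lam0 hlam0 ∘ₗ
      (π.toLinearMap.quotKerEquivOfSurjective hπ).symm.toLinearMap, fun g => ?_⟩
    have : (π.toLinearMap.quotKerEquivOfSurjective hπ).symm (π g) = Submodule.Quotient.mk g := by
      rw [LinearEquiv.symm_apply_eq]; rfl
    simp only [LinearMap.comp_apply, LinearEquiv.coe_coe]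
    rw [this]; rfl
  refine ⟨lam, TT.det.support, fun m => TT.det.coeff m, fun m => π (monomial m 1), fun y => ?_⟩
  obtain ⟨g, rfl⟩ := hπ y
  have h1 : π g = τ' (mp α * TT.det * mp g) := by
    rw [← hev, ← hQg, ← sub_eq_zero, ← map_sub, ← sub_mul]
    apply hτ'P
    apply Ideal.mul_mem_right
    rw [← neg_mem_iff, neg_sub]; exact hdet
  conv_lhs => rw [h1, TT.det.as_sum, Finset.mul_sum, Finset.sum_mul, map_sum]
  refine Finset.sum_congr rfl fun m _ => ?_
  rw [← map_mul, hlam]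
  have e : mp α * monomial m (TT.det.coeff m) * mp g = TT.det.coeff m • mp (α * (monomial m 1 * g)) := by
    rw [map_mul, map_mul]
    have : mp (monomial m 1) = monomial m 1 := by simp [mp]
    rw [this, show monomial m (TT.det.coeff m) = C (TT.det.coeff m) * monomial m 1 by rw [C_mul_monomial, mul_one], smul_eq_C_mul]
    ring
  rw [e, map_smul, hττ, smul_eq_mul, mul_comm, Algebra.smul_def]


open MvPolynomial in
theorem fib1 {σ ι : Type} [Fintype σ] (e : σ ≃ ι) (Sg : ι → MvPolynomial σ ℂ)
    (hint : ∀ v, (aeval Sg : MvPolynomial ι ℂ →ₐ[ℂ] MvPolynomial σ ℂ).toRingHom.IsIntegralElem (X v)) :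
    ∃ (lam : MvPolynomial σ ℂ →+ MvPolynomial ι ℂ) (s : Finset (σ →₀ ℕ))
      (a b : (σ →₀ ℕ) → MvPolynomial σ ℂ),
      (∀ r x, lam (aeval Sg r * x) = r * lam x) ∧
      ∀ x, x = ∑ i ∈ s, aeval Sg (lam (b i * x)) * a i := by
  let _ : Algebra (MvPolynomial ι ℂ) (MvPolynomial σ ℂ) :=
    (aeval Sg : MvPolynomial ι ℂ →ₐ[ℂ] MvPolynomial σ ℂ).toRingHom.toAlgebra
  have hal : ∀ r, algebraMap (MvPolynomial ι ℂ) (MvPolynomial σ ℂ) r = aeval Sg r := fun r => rfl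
  let π : MvPolynomial σ (MvPolynomial ι ℂ) →ₐ[MvPolynomial ι ℂ] MvPolynomial σ ℂ := aeval X
  let up : MvPolynomial σ ℂ →+* MvPolynomial σ (MvPolynomial ι ℂ) := map C
  have hup : ∀ g, π (up g) = g := by
    intro g
    have : (π.toRingHom.comp up) = RingHom.id _ := by
      apply MvPolynomial.ringHom_ext
      · intro r
        simp [π, up, hal]
      · intro k; simp [π, up]
    exact congrArg (fun f : MvPolynomial σ ℂ →+* _ => f g) this
  let F : σ → MvPolynomial σ (MvPolynomial ι ℂ) := fun v => up (Sg (e v)) - C (X (e v))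
  have hF : ∀ v, π (F v) = 0 := by
    intro v
    simp only [F, map_sub, hup]
    simp [π, hal]
  have hker : RingHom.ker π = Ideal.span (Set.range F) := by
    apply le_antisymm
    · intro g hg
      rw [RingHom.mem_ker] at hg
      rw [← Ideal.Quotient.eq_zero_iff_mem]
      set I := Ideal.span (Set.range F)
      have : Ideal.Quotient.mk I = ((Ideal.Quotient.mk I).comp up).comp π.toRingHom := by
        apply MvPolynomial.ringHom_ext
        · intro r
          have : ((Ideal.Quotient.mk I).comp C) = ((Ideal.Quotient.mk I).comp up).comp (aeval Sg : MvPolynomial ι ℂ →ₐ[ℂ] MvPolynomial σ ℂ).toRingHom := by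
            apply MvPolynomial.ringHom_ext
            · intro z; simp [up]
            · intro k
              simp only [RingHom.comp_apply]
              rw [Ideal.Quotient.eq, ← neg_mem_iff, neg_sub]
              apply Ideal.subset_span
              refine ⟨e.symm k, ?_⟩
              simp [F]
          have h := congrArg (fun f : MvPolynomial ι ℂ →+* _ => f r) this
          simp only [RingHom.comp_apply] at h
          simp only [RingHom.comp_apply, h]
          congr 2
          simp [π, hal]
        · intro k
          simp [π, up]
      rw [this, RingHom.comp_apply]
      have h0 : π.toRingHom g = 0 := hg
      rw [h0, map_zero]
    · rw [Ideal.span_le]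
      rintro _ ⟨v, rfl⟩
      exact hF v
  obtain ⟨lam, s, a, b, h⟩ := core π (fun g => ⟨up g, hup g⟩) F hker (fun v => by
    have : π (X v) = X v := by simp [π]
    rw [this]; exact hint v)
  refine ⟨lam.toAddMonoidHom, s, a, b, fun r x => ?_, fun x => ?_⟩
  · change lam _ = r * lam x
    rw [← hal, ← Algebra.smul_def, map_smul, smul_eq_mul]
  · exact h x

theorem aux_trace {K V ι : Type*} [Field K] [AddCommGroup V] [Module K V] [FiniteDimensional K V]
    (s : Finset ι) (φ : ι → V →ₗ[K] K) (a : ι → V) (h : ∀ x, x = ∑ i ∈ s, φ i x • a i) :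
    (Module.finrank K V : K) = ∑ i ∈ s, φ i (a i) := by
  rw [← LinearMap.trace_id]
  have : (LinearMap.id : V →ₗ[K] V) = ∑ i ∈ s, LinearMap.smulRight (φ i) (a i) := by
    ext1 x
    conv_lhs => rw [LinearMap.id_apply, h x]
    simp
  rw [this, map_sum]
  exact Finset.sum_congr rfl fun i _ => LinearMap.trace_smulRight _ _

set_option maxHeartbeats 1000000 in
open MvPolynomial in
theorem fib2 {σ ι : Type} [Fintype σ] [Fintype ι] (e : σ ≃ ι) (Sg : ι → MvPolynomial σ ℂ)
    (hint : ∀ v, (aeval Sg : MvPolynomial ι ℂ →ₐ[ℂ] MvPolynomial σ ℂ).toRingHom.IsIntegralElem (X v))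
    (I : (ι → ℂ) → Ideal (MvPolynomial σ ℂ))
    (hI : ∀ a, I a = Ideal.span (Set.range fun s => Sg s - C (a s))) :
    (∀ a : ι → ℂ,
      FiniteDimensional ℂ (MvPolynomial σ ℂ ⧸ I a) ∧
      ∃ b : (MvPolynomial σ ℂ ⧸ I a) →ₗ[ℂ] (MvPolynomial σ ℂ ⧸ I a) →ₗ[ℂ] ℂ,
        (∀ x y, b x y = b y x) ∧
        (∀ x y z, b (x * y) z = b x (y * z)) ∧
        (∀ x, (∀ y, b x y = 0) → x = 0)) ∧
    ∀ a a' : ι → ℂ,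
      Module.finrank ℂ (MvPolynomial σ ℂ ⧸ I a) =
        Module.finrank ℂ (MvPolynomial σ ℂ ⧸ I a') := by
  classical
  obtain ⟨lam, s, a, b, hlam, hx⟩ := fib1 e Sg hint
  have hsmul : ∀ (z : ℂ) x, lam (z • x) = z • lam x := by
    intro z x
    have := hlam (C z) x
    rwa [aeval_C, ← Algebra.smul_def, ← smul_eq_C_mul] at this
  have hmk : ∀ p (r : MvPolynomial ι ℂ), Ideal.Quotient.mk (I p) (aeval Sg r) =
      algebraMap ℂ _ (eval p r) := by
    intro p r
    have : ((Ideal.Quotient.mk (I p)).comp (aeval Sg : MvPolynomial ι ℂ →ₐ[ℂ] MvPolynomial σ ℂ).toRingHom) =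
        (algebraMap ℂ (MvPolynomial σ ℂ ⧸ I p)).comp (eval p) := by
      apply MvPolynomial.ringHom_ext
      · intro z; simp; rfl
      · intro k
        simp only [RingHom.comp_apply, eval_X]
        have : algebraMap ℂ (MvPolynomial σ ℂ ⧸ I p) (p k) = Ideal.Quotient.mk (I p) (C (p k)) := rfl
        rw [this, Ideal.Quotient.eq, hI]
        apply Ideal.subset_span
        exact ⟨k, by simp⟩
    exact congrArg (fun f : MvPolynomial ι ℂ →+* _ => f r) this
  -- fiber functional
  have hL : ∀ p, ∃ L : (MvPolynomial σ ℂ ⧸ I p) →ₗ[ℂ] ℂ, ∀ x,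
      L (Ideal.Quotient.mk (I p) x) = eval p (lam x) := by
    intro p
    let L0 : MvPolynomial σ ℂ →ₗ[ℂ] ℂ :=
      { toFun := fun x => eval p (lam x)
        map_add' := fun x y => by simp
        map_smul' := fun z x => by rw [hsmul, smul_eval]; rfl }
    have h0 : (I p).restrictScalars ℂ ≤ LinearMap.ker L0 := by
      intro g hg
      have hg : g ∈ I p := hg
      rw [hI] at hg
      obtain ⟨w, rfl⟩ := Ideal.mem_span_range_iff_exists_fun.mp hg
      rw [LinearMap.mem_ker, map_sum]
      refine Finset.sum_eq_zero fun k _ => ?_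
      change eval p (lam _) = 0
      have : w k * (Sg k - C (p k)) = aeval Sg (X k - C (p k)) * w k := by
        rw [map_sub, aeval_X, aeval_C, mul_comm]; rfl
      rw [this, hlam]; simp
    exact ⟨((I p).restrictScalars ℂ).liftQ L0 h0, fun x => rfl⟩
  choose L hL using hL
  have hrep : ∀ p (x : MvPolynomial σ ℂ ⧸ I p),
      x = ∑ i ∈ s, L p (Ideal.Quotient.mk (I p) (b i) * x) • Ideal.Quotient.mk (I p) (a i) := by
    intro p x
    obtain ⟨x, rfl⟩ := Ideal.Quotient.mk_surjective x
    conv_lhs => rw [hx x, map_sum]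
    refine Finset.sum_congr rfl fun i _ => ?_
    rw [map_mul, hmk, ← Algebra.smul_def, ← map_mul, hL]
  have hspan : ∀ p, Submodule.span ℂ ((s.image fun i => Ideal.Quotient.mk (I p) (a i) :
      Finset (MvPolynomial σ ℂ ⧸ I p)) : Set (MvPolynomial σ ℂ ⧸ I p)) = ⊤ := by
    intro p
    rw [eq_top_iff]
    intro x _
    rw [hrep p x]
    refine Submodule.sum_mem _ fun i hi => Submodule.smul_mem _ _ (Submodule.subset_span ?_)
    exact Finset.mem_coe.mpr (Finset.mem_image_of_mem _ hi)
  have hfd : ∀ p, FiniteDimensional ℂ (MvPolynomial σ ℂ ⧸ I p) := fun p =>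
    ⟨⟨_, hspan p⟩⟩
  refine ⟨fun p => ⟨hfd p, (LinearMap.mul ℂ (MvPolynomial σ ℂ ⧸ I p)).compr₂ (L p), ?_, ?_, ?_⟩, ?_⟩
  · intro x y; simp [mul_comm]
  · intro x y z; simp [mul_assoc]
  · intro x h
    rw [hrep p x]
    refine Finset.sum_eq_zero fun i _ => ?_
    have := h (Ideal.Quotient.mk (I p) (b i))
    simp only [LinearMap.compr₂_apply, LinearMap.mul_apply'] at this
    rw [mul_comm, this, zero_smul]
  · let t : MvPolynomial ι ℂ := ∑ i ∈ s, lam (b i * a i)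
    have ht : ∀ p, (Module.finrank ℂ (MvPolynomial σ ℂ ⧸ I p) : ℂ) = eval p t := by
      intro p
      have := hfd p
      rw [aux_trace s (fun i => L p ∘ₗ LinearMap.mulLeft ℂ (Ideal.Quotient.mk (I p) (b i)))
        (fun i => Ideal.Quotient.mk (I p) (a i)) (hrep p), map_sum]
      refine Finset.sum_congr rfl fun i _ => ?_
      rw [← hL, map_mul]; rfl
    have hle : ∀ p, Module.finrank ℂ (MvPolynomial σ ℂ ⧸ I p) ≤ s.card := by
      intro p
      have h := finrank_span_finset_le_card (R := ℂ) (s.image fun i => Ideal.Quotient.mk (I p) (a i))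
      rw [Set.finrank, hspan p, finrank_top] at h
      exact h.trans Finset.card_image_le
    have hprod : ∏ k ∈ Finset.range (s.card + 1), (t - C (k : ℂ)) = 0 := by
      apply MvPolynomial.funext
      intro p
      rw [map_prod, map_zero]
      refine Finset.prod_eq_zero (Finset.mem_range.mpr (Nat.lt_succ_of_le (hle p))) ?_
      rw [map_sub, eval_C, ht, sub_self]
    obtain ⟨k, _, hk⟩ := Finset.prod_eq_zero_iff.mp hprod
    rw [sub_eq_zero] at hk
    intro p p'
    have h1 := ht p
    have h2 := ht p'
    rw [hk, eval_C] at h1 h2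
    exact_mod_cast h1.trans h2.symm


open MvPolynomial in
theorem comp_mul {σ : Type} (w : σ → ℕ) (W k : ℕ) (h S : MvPolynomial σ ℂ)
    (hS : IsWeightedHomogeneous w S k) :
    weightedHomogeneousComponent w W (h * S) =
      if k ≤ W then weightedHomogeneousComponent w (W - k) h * S else 0 := by
  classical
  induction h using MvPolynomial.induction_on' with
  | monomial m c =>
    have hm : IsWeightedHomogeneous w (monomial m c) (Finsupp.weight w m) :=
      isWeightedHomogeneous_monomial w m c rfl
    by_cases hk : Finsupp.weight w m + k = W
    · rw [if_pos (by omega)]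
      have h1 : W - k = Finsupp.weight w m := by omega
      have h2 := hm.mul hS
      rw [hk] at h2
      rw [h1, hm.weightedHomogeneousComponent_same, h2.weightedHomogeneousComponent_same]
    · rw [(hm.mul hS).weightedHomogeneousComponent_ne W (fun h => hk h.symm)]
      split_ifs with h1
      · rw [hm.weightedHomogeneousComponent_ne (W - k) (by omega), zero_mul]
      · rfl
  | add p q hp hq =>
    rw [add_mul, map_add, hp, hq]
    split_ifs
    · rw [map_add, add_mul]
    · simp

open MvPolynomial in
theorem graded_int {σ ι : Type} [Fintype σ] [Fintype ι] (w : σ → ℕ) (deg : ι → ℕ)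
    (hdeg : ∀ s, 0 < deg s) (Sg : ι → MvPolynomial σ ℂ)
    (hhom : ∀ s, IsWeightedHomogeneous w (Sg s) (deg s))
    (hzero : ∀ p : σ → ℂ, (∀ s, eval p (Sg s) = 0) → p = 0) :
    ∀ v, (aeval Sg : MvPolynomial ι ℂ →ₐ[ℂ] MvPolynomial σ ℂ).toRingHom.IsIntegralElem (X v) := by
  classical
  have hrad : ∀ v : σ, (X v : MvPolynomial σ ℂ) ∈ (Ideal.span (Set.range Sg)).radical := by
    intro v
    rw [← vanishingIdeal_zeroLocus_eq_radical (K := ℂ), mem_vanishingIdeal_iff]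
    intro x hx
    rw [mem_zeroLocus_iff] at hx
    have := hzero x (fun s => by
      have := hx (Sg s) (Ideal.subset_span ⟨s, rfl⟩)
      simpa [MvPolynomial.aeval_eq_eval] using this)
    simp [this]
  choose K0 hK0 using hrad
  obtain ⟨K, hK⟩ : ∃ K : ℕ, ∀ v, K0 v ≤ K := ⟨∑ v, K0 v, fun v =>
    Finset.single_le_sum (f := K0) (fun _ _ => Nat.zero_le _) (Finset.mem_univ v)⟩
  have hXK : ∀ v : σ, ∃ c : ι → MvPolynomial σ ℂ, ∑ s, c s * Sg s = X v ^ K := by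
    intro v
    have : (X v : MvPolynomial σ ℂ) ^ K ∈ Ideal.span (Set.range Sg) :=
      Ideal.pow_mem_of_pow_mem _ (hK0 v) (hK v)
    rw [Ideal.mem_span_range_iff_exists_fun] at this
    exact this
  let _ : Algebra (MvPolynomial ι ℂ) (MvPolynomial σ ℂ) :=
    (aeval Sg : MvPolynomial ι ℂ →ₐ[ℂ] MvPolynomial σ ℂ).toRingHom.toAlgebra
  have hsmul : ∀ (b : MvPolynomial ι ℂ) (x : MvPolynomial σ ℂ), b • x = aeval Sg b * x :=
    fun b x => rfl
  let box : Set (σ →₀ ℕ) := Set.Iic (Finsupp.equivFunOnFinite.symm fun _ => K)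
  have hbox : box.Finite := Set.finite_Iic _
  let M : Submodule (MvPolynomial ι ℂ) (MvPolynomial σ ℂ) :=
    Submodule.span _ ((fun m => monomial m (1 : ℂ)) '' box)
  have hMX : ∀ s g, g ∈ M → g * Sg s ∈ M := by
    intro s g hg
    have := M.smul_mem (X s) hg
    rw [hsmul, aeval_X, mul_comm] at this
    exact this
  have hMC : ∀ (c : ℂ) g, g ∈ M → C c * g ∈ M := by
    intro c g hg
    have := M.smul_mem (C c) hg
    rw [hsmul, aeval_C] at this
    exact this
  have key : ∀ W : ℕ, ∀ g : MvPolynomial σ ℂ, IsWeightedHomogeneous w g W → g ∈ M := by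
    intro W
    induction W using Nat.strong_induction_on with
    | _ W ih =>
    intro g hg
    rw [g.as_sum]
    refine Submodule.sum_mem _ fun m hm => ?_
    have hmW : Finsupp.weight w m = W := hg (mem_support_iff.1 hm)
    by_cases hb : m ∈ box
    · have : monomial m (coeff m g) = C (coeff m g) * monomial m 1 := by
        rw [C_mul_monomial, mul_one]
      rw [this]
      exact hMC _ _ (Submodule.subset_span ⟨m, hb, rfl⟩)
    · have : ∃ v, K < m v := by
        by_contra hcon
        push Not at hcon
        exact hb (fun v => by simpa using hcon v)
      obtain ⟨v, hv⟩ := this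
      obtain ⟨c, hc⟩ := hXK v
      set q := monomial (m - Finsupp.single v K) (coeff m g) with hq
      have h1 : monomial m (coeff m g) = q * X v ^ K := by
        rw [hq, X_pow_eq_monomial, monomial_mul, mul_one]
        congr 1
        rw [tsub_add_cancel_of_le]
        rw [Finsupp.single_le_iff]; exact hv.le
      have h2 : IsWeightedHomogeneous w (monomial m (coeff m g)) W :=
        isWeightedHomogeneous_monomial w m _ hmW
      rw [← h2.weightedHomogeneousComponent_same, h1, ← hc, Finset.mul_sum, map_sum]
      refine Submodule.sum_mem _ fun s _ => ?_
      rw [← mul_assoc, comp_mul w W (deg s) _ _ (hhom s)]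
      split_ifs with h3
      · apply hMX
        have := hdeg s
        exact ih (W - deg s) (by omega) _
          (weightedHomogeneousComponent_isWeightedHomogeneous _ _)
      · exact M.zero_mem
  have htop : M = ⊤ := by
    rw [eq_top_iff]
    intro g _
    rw [g.as_sum]
    exact Submodule.sum_mem _ fun m _ => key _ _ (isWeightedHomogeneous_monomial w m _ rfl)
  have hfin : Module.Finite (MvPolynomial ι ℂ) (MvPolynomial σ ℂ) := by
    refine ⟨?_⟩
    rw [← htop]
    exact Submodule.fg_span (hbox.image _)
  intro v
  exact Algebra.IsIntegral.isIntegral (R := MvPolynomial ι ℂ) (X v)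


theorem coeff_theta {R : Type*} [CommRing R] (h : Polynomial R) (j m : ℕ) :
    (Polynomial.X ^ j * (Polynomial.derivative^[j] h)).coeff m =
      (m.descFactorial j : R) * h.coeff m := by
  rw [Polynomial.coeff_X_pow_mul']
  split_ifs with hj
  · rw [Polynomial.coeff_iterate_derivative, Nat.sub_add_cancel hj, nsmul_eq_mul]
  · rw [Nat.descFactorial_eq_zero_iff_lt.2 (by omega)]
    simp

theorem wron_theta {R : Type*} [CommRing R] (N : ℕ) (f : Fin N → Polynomial R) :
    Polynomial.X ^ (∑ j : Fin N, (j : ℕ)) * wronR N f =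
      (Matrix.of fun i j : Fin N =>
        (Polynomial.X ^ (j : ℕ) * (Polynomial.derivative^[(j : ℕ)] (f i)))).det := by
  rw [wronR, ← Finset.prod_pow_eq_pow_sum]
  exact (Matrix.det_mul_row (fun j : Fin N => (Polynomial.X : Polynomial R) ^ (j : ℕ))
    (Matrix.of fun i j : Fin N => (Polynomial.derivative^[(j : ℕ)] (f i)))).symm

def IsH {σ : Type} (wt : σ → ℕ) (D : ℕ) (g : Polynomial (MvPolynomial σ ℂ)) : Prop :=
  ∀ m, (m ≤ D → MvPolynomial.IsWeightedHomogeneous wt (g.coeff m) (D - m)) ∧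
    (D < m → g.coeff m = 0)

theorem IsH.mul {σ : Type} {wt : σ → ℕ} {D E : ℕ} {g h : Polynomial (MvPolynomial σ ℂ)}
    (hg : IsH wt D g) (hh : IsH wt E h) : IsH wt (D + E) (g * h) := by
  intro m
  rw [Polynomial.coeff_mul]
  constructor
  · intro hm
    refine MvPolynomial.IsWeightedHomogeneous.sum _ _ _ fun p hp => ?_
    rw [Finset.HasAntidiagonal.mem_antidiagonal] at hp
    by_cases h1 : D < p.1
    · rw [(hg p.1).2 h1, zero_mul]; exact MvPolynomial.isWeightedHomogeneous_zero _ _ _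
    by_cases h2 : E < p.2
    · rw [(hh p.2).2 h2, mul_zero]; exact MvPolynomial.isWeightedHomogeneous_zero _ _ _
    have := ((hg p.1).1 (by omega)).mul ((hh p.2).1 (by omega))
    have e : D + E - m = D - p.1 + (E - p.2) := by omega
    rw [e]; exact this
  · intro hm
    refine Finset.sum_eq_zero fun p hp => ?_
    rw [Finset.HasAntidiagonal.mem_antidiagonal] at hp
    by_cases h1 : D < p.1
    · rw [(hg p.1).2 h1, zero_mul]
    · rw [(hh p.2).2 (by omega), mul_zero]

theorem IsH.sum {σ κ : Type} {wt : σ → ℕ} {D : ℕ} (s : Finset κ)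
    (g : κ → Polynomial (MvPolynomial σ ℂ))
    (hg : ∀ i ∈ s, IsH wt D (g i)) : IsH wt D (∑ i ∈ s, g i) := by
  intro m
  rw [Polynomial.finsetSum_coeff]
  exact ⟨fun hm => MvPolynomial.IsWeightedHomogeneous.sum _ _ _ fun p hp => (hg p hp m).1 hm,
    fun hm => Finset.sum_eq_zero fun p hp => (hg p hp m).2 hm⟩

theorem IsH.prod {σ κ : Type} {wt : σ → ℕ} (s : Finset κ) (D : κ → ℕ)
    (g : κ → Polynomial (MvPolynomial σ ℂ))
    (hg : ∀ i ∈ s, IsH wt (D i) (g i)) : IsH wt (∑ i ∈ s, D i) (∏ i ∈ s, g i) := by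
  classical
  induction s using Finset.induction_on with
  | empty =>
    intro m
    simp only [Finset.sum_empty, Finset.prod_empty]
    constructor
    · intro hm
      obtain rfl : m = 0 := by omega
      simpa using MvPolynomial.isWeightedHomogeneous_one ℂ wt
    · intro hm
      rw [Polynomial.coeff_one, if_neg (by omega)]
  | insert a s ha ih =>
    rw [Finset.sum_insert ha, Finset.prod_insert ha]
    exact (hg a (Finset.mem_insert_self _ _)).mul
      (ih fun i hi => hg i (Finset.mem_insert_of_mem hi))

theorem IsH.neg {σ : Type} {wt : σ → ℕ} {D : ℕ} {g : Polynomial (MvPolynomial σ ℂ)}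
    (hg : IsH wt D g) : IsH wt D (-g) := by
  intro m
  rw [Polynomial.coeff_neg]
  exact ⟨fun hm => ((hg m).1 hm).neg, fun hm => by rw [(hg m).2 hm, neg_zero]⟩

theorem IsH.det {σ : Type} {wt : σ → ℕ} {N : ℕ} (D : Fin N → ℕ)
    (A : Matrix (Fin N) (Fin N) (Polynomial (MvPolynomial σ ℂ)))
    (hA : ∀ i j, IsH wt (D i) (A i j)) : IsH wt (∑ i, D i) A.det := by
  rw [Matrix.det_apply]
  refine IsH.sum _ _ fun τ _ => ?_
  have h1 : IsH wt (∑ i, D i) (∏ i, A (τ i) i) := by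
    rw [← Equiv.sum_comp τ D]
    exact IsH.prod _ (fun i => D (τ i)) _ fun i _ => hA _ _
  rcases Int.units_eq_one_or (Equiv.Perm.sign τ) with h | h
  · rw [h, one_smul]; exact h1
  · rw [h, Units.neg_smul, one_smul]; exact h1.neg

/-- weights of the variables -/
def svWt (N : ℕ) (d : Fin N → ℕ) (v : SchubertVar N d) : ℕ := v.1.2

/-- variables -/
def mkV (N : ℕ) (d : Fin N → ℕ) (i : Fin N) (j : ℕ)
    (h : 1 ≤ j ∧ j ≤ d i ∧ d i - j ∉ Set.range d) : SchubertVar N d := ⟨(i, j), h⟩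

theorem genFun_eq (N : ℕ) (d : Fin N → ℕ) (i : Fin N) :
    genFun N d i = (Polynomial.X ^ (d i) +
    ∑ j ∈ Finset.Icc 1 (d i),
      if h : 1 ≤ j ∧ j ≤ d i ∧ d i - j ∉ Set.range d then
        Polynomial.C (MvPolynomial.X (mkV N d i j h)) * Polynomial.X ^ (d i - j)
      else 0 : Polynomial (MvPolynomial (SchubertVar N d) ℂ)) := rfl

theorem coeff_genFun (N : ℕ) (d : Fin N → ℕ) (i : Fin N) (m : ℕ) :
    (genFun N d i).coeff m = (if m = d i then 1 else 0) +
      (if h : m < d i ∧ m ∉ Set.range d then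
        MvPolynomial.X (mkV N d i (d i - m) (by
          refine ⟨by have := h.1; omega, Nat.sub_le _ _, ?_⟩
          have := h.1
          have e : d i - (d i - m) = m := by omega
          rw [e]; exact h.2)) else 0) := by
  rw [genFun_eq, Polynomial.coeff_add, Polynomial.coeff_X_pow, Polynomial.finsetSum_coeff]
  congr 1
  split_ifs with h
  · rw [Finset.sum_eq_single (d i - m)]
    · have := h.1
      have e : d i - (d i - m) = m := by omega
      rw [dif_pos ⟨by omega, by omega, by rw [e]; exact h.2⟩, Polynomial.coeff_C_mul,
        Polynomial.coeff_X_pow, if_pos e.symm, mul_one]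
    · intro j hj hne
      rw [Finset.mem_Icc] at hj
      split_ifs
      · rw [Polynomial.coeff_C_mul, Polynomial.coeff_X_pow, if_neg (by omega), mul_zero]
      · simp
    · intro hh
      exfalso; apply hh
      rw [Finset.mem_Icc]; omega
  · refine Finset.sum_eq_zero fun j hj => ?_
    rw [Finset.mem_Icc] at hj
    split_ifs with h2
    · rw [Polynomial.coeff_C_mul, Polynomial.coeff_X_pow, if_neg, mul_zero]
      rintro rfl
      exact h ⟨by omega, h2.2.2⟩
    · simp

theorem isH_theta_genFun (N : ℕ) (d : Fin N → ℕ) (i : Fin N) (j : ℕ) :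
    IsH (svWt N d) (d i) (Polynomial.X ^ j * (Polynomial.derivative^[j] (genFun N d i))) := by
  intro m
  rw [coeff_theta, coeff_genFun]
  constructor
  · intro hm
    have hc : ((m.descFactorial j : ℕ) : MvPolynomial (SchubertVar N d) ℂ) =
      MvPolynomial.C ((m.descFactorial j : ℕ) : ℂ) := by simp
    rw [hc]
    apply MvPolynomial.IsWeightedHomogeneous.C_mul
    apply MvPolynomial.IsWeightedHomogeneous.add
    · split_ifs with h
      · rw [h, Nat.sub_self]; exact MvPolynomial.isWeightedHomogeneous_one _ _
      · exact MvPolynomial.isWeightedHomogeneous_zero _ _ _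
    · split_ifs with h
      · exact MvPolynomial.isWeightedHomogeneous_X ℂ (svWt N d) _
      · exact MvPolynomial.isWeightedHomogeneous_zero _ _ _
  · intro hm
    rw [if_neg (by omega), dif_neg (by omega), add_zero, mul_zero]

theorem sigma_hom (N : ℕ) (d : Fin N → ℕ) (n s : ℕ) (hs : s ≤ n)
    (hsum : ∑ i, d i = n + ∑ j : Fin N, (j : ℕ)) :
    MvPolynomial.IsWeightedHomogeneous (svWt N d) (SigmaEl N d n s) s := by
  have h1 : IsH (svWt N d) (∑ i, d i)
      (Polynomial.X ^ (∑ j : Fin N, (j : ℕ)) * wronR N (genFun N d)) := by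
    rw [wron_theta]
    exact IsH.det d _ fun i j => isH_theta_genFun N d i j
  have h2 := (h1 (n - s + ∑ j : Fin N, (j : ℕ))).1 (by omega)
  rw [Polynomial.coeff_X_pow_mul] at h2
  have e : ∑ i, d i - (n - s + ∑ j : Fin N, (j : ℕ)) = s := by omega
  rw [e] at h2
  rw [SigmaEl, MvPolynomial.smul_eq_C_mul]
  exact h2.C_mul _

theorem det_desc_ne {N : ℕ} (e : Fin N → ℕ) (he : Function.Injective e) :
    (Matrix.of fun i j : Fin N => (((e i).descFactorial (j : ℕ) : ℕ) : ℂ)).det ≠ 0 := by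
  have h := Matrix.det_eval_matrixOfPolynomials_eq_det_vandermonde (fun i : Fin N => (e i : ℂ))
    (fun j : Fin N => descPochhammer ℂ (j : ℕ)) (fun j => descPochhammer_natDegree _ _)
    (fun j => monic_descPochhammer _ _)
  have h2 : (Matrix.of fun i j : Fin N => (((e i).descFactorial (j : ℕ) : ℕ) : ℂ)) =
      Matrix.of (fun i j : Fin N => (descPochhammer ℂ (j : ℕ)).eval (e i : ℂ)) := by
    ext i j
    simp [descPochhammer_eval_eq_descFactorial]
  rw [h2, ← h, Matrix.det_vandermonde_ne_zero_iff]
  intro a b hab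
  have hab' : (e a : ℂ) = (e b : ℂ) := hab
  exact he (by exact_mod_cast hab')

theorem wron_low {N : ℕ} (h : Fin N → Polynomial ℂ) (e : Fin N → ℕ)
    (he : Function.Injective e) (h0 : ∀ i, ∀ k < e i, (h i).coeff k = 0)
    (h1 : ∀ i, (h i).coeff (e i) ≠ 0) :
    (Polynomial.X ^ (∑ j : Fin N, (j : ℕ)) * wronR N h).coeff (∑ i, e i) ≠ 0 := by
  have hdvd : ∀ i j : Fin N, ∃ r : Polynomial ℂ,
      Polynomial.X ^ (j : ℕ) * (Polynomial.derivative^[(j : ℕ)] (h i)) =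
        Polynomial.X ^ (e i) * r := by
    intro i j
    have : Polynomial.X ^ (e i) ∣
        Polynomial.X ^ (j : ℕ) * (Polynomial.derivative^[(j : ℕ)] (h i)) := by
      rw [Polynomial.X_pow_dvd_iff]
      intro k hk
      rw [coeff_theta, h0 i k hk, mul_zero]
    exact this
  choose r hr using hdvd
  have hr0 : ∀ i j, (r i j).coeff 0 =
      (h i).coeff (e i) * (((e i).descFactorial (j : ℕ) : ℕ) : ℂ) := by
    intro i j
    have h2 : (Polynomial.X ^ (e i) * r i j).coeff (0 + e i) = (r i j).coeff 0 :=
      Polynomial.coeff_X_pow_mul _ _ _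
    rw [← h2, ← hr i j, coeff_theta, zero_add, mul_comm]
  rw [wron_theta]
  have h3 : (Matrix.of fun i j : Fin N =>
        (Polynomial.X ^ (j : ℕ) * (Polynomial.derivative^[(j : ℕ)] (h i)))) =
      Matrix.of fun i j : Fin N => (fun i => (Polynomial.X : Polynomial ℂ) ^ (e i)) i *
        (Matrix.of r) i j := by
    ext1 i j
    exact hr i j
  rw [h3, Matrix.det_mul_column, Finset.prod_pow_eq_pow_sum]
  have h4 : (Polynomial.X ^ (∑ i, e i) * (Matrix.of r).det).coeff (0 + ∑ i, e i) =
      (Matrix.of r).det.coeff 0 := Polynomial.coeff_X_pow_mul _ _ _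
  rw [zero_add] at h4
  rw [h4, ← Polynomial.constantCoeff_apply, RingHom.map_det]
  have h5 : Polynomial.constantCoeff.mapMatrix (Matrix.of r) =
      Matrix.of fun i j : Fin N => (fun i => (h i).coeff (e i)) i *
        (Matrix.of fun i j : Fin N => (((e i).descFactorial (j : ℕ) : ℕ) : ℂ)) i j := by
    ext i j
    exact hr0 i j
  rw [h5, Matrix.det_mul_column]
  exact mul_ne_zero (Finset.prod_ne_zero_iff.2 fun i _ => h1 i) (det_desc_ne e he)

theorem wron_update {N : ℕ} (h : Fin N → Polynomial ℂ) (i k : Fin N) (hik : i ≠ k) (c : ℂ) :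
    wronR N (Function.update h i (h i - Polynomial.C c * h k)) = wronR N h := by
  rw [wronR, wronR, ← Matrix.det_updateRow_add_smul_self
    (Matrix.of fun i j : Fin N => (Polynomial.derivative^[(j : ℕ)] (h i))) hik (-Polynomial.C c)]
  congr 1
  ext1 a j
  by_cases ha : a = i
  · subst ha
    simp [Matrix.updateRow_self, Polynomial.iterate_derivative_C_mul, sub_eq_add_neg]
  · simp [Matrix.updateRow_ne ha, Function.update_of_ne ha]

theorem wron_reduce {N : ℕ} (d : Fin N → ℕ) (hd : Function.Injective d)
    (f : Fin N → Polynomial ℂ) : ∀ (M : ℕ) (h : Fin N → Polynomial ℂ),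
    (∀ i, (h i).Monic) → (∀ i, (h i).natDegree = d i) → wronR N h = wronR N f →
    (∀ i, f i ∈ Submodule.span ℂ (Set.range h)) →
    (∑ i, d i - ∑ i, (h i).natTrailingDegree = M) →
    ∃ h' : Fin N → Polynomial ℂ,
    (∀ i, (h' i).Monic) ∧ (∀ i, (h' i).natDegree = d i) ∧ wronR N h' = wronR N f ∧
    (∀ i, f i ∈ Submodule.span ℂ (Set.range h')) ∧
    Function.Injective fun i => (h' i).natTrailingDegree := by
  intro M
  induction M using Nat.strong_induction_on with
  | _ M ih =>
  intro h hm hdg hw hsp hM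
  by_cases hinj : Function.Injective fun i => (h i).natTrailingDegree
  · exact ⟨h, hm, hdg, hw, hsp, hinj⟩
  have hex : ∃ i k, i ≠ k ∧ (h i).natTrailingDegree = (h k).natTrailingDegree ∧ d k < d i := by
    simp only [Function.Injective, not_forall] at hinj
    obtain ⟨i, k, h1, h2⟩ := hinj
    rcases lt_trichotomy (d k) (d i) with h3 | h3 | h3
    · exact ⟨i, k, h2, h1, h3⟩
    · exact absurd (hd h3) (fun h => h2 h.symm)
    · exact ⟨k, i, fun h => h2 h.symm, h1.symm, h3⟩
  obtain ⟨i, k, hik, he, hlt⟩ := hex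
  have hne : ∀ i, h i ≠ 0 := fun i => (hm i).ne_zero
  set e := (h k).natTrailingDegree with hedef
  have hck : (h k).coeff e ≠ 0 := by
    have := Polynomial.trailingCoeff_nonzero_iff_nonzero.2 (hne k)
    exact this
  set c := (h i).coeff e / (h k).coeff e with hc
  set g := h i - Polynomial.C c * h k with hg
  have hgd : (Polynomial.C c * h k).natDegree < (h i).natDegree := by
    refine lt_of_le_of_lt (Polynomial.natDegree_C_mul_le _ _) ?_
    rw [hdg, hdg]; exact hlt
  have hgdeg : g.natDegree = d i := by
    rw [hg, Polynomial.natDegree_sub_eq_left_of_natDegree_lt hgd, hdg]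
  have hgm : g.Monic := by
    rw [hg]
    exact Polynomial.Monic.sub_of_left (hm i) (Polynomial.degree_lt_degree hgd)
  have hgt : e + 1 ≤ g.natTrailingDegree := by
    apply Polynomial.le_natTrailingDegree hgm.ne_zero
    intro m hme
    rw [hg, Polynomial.coeff_sub, Polynomial.coeff_C_mul]
    rcases Nat.lt_succ_iff_lt_or_eq.1 hme with h1 | h1
    · rw [Polynomial.coeff_eq_zero_of_lt_natTrailingDegree (by rw [he]; exact h1),
        Polynomial.coeff_eq_zero_of_lt_natTrailingDegree (p := h k) h1]
      simp
    · rw [h1, hc, div_mul_cancel₀ _ hck, sub_self]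
  set h' := Function.update h i g with hh'
  have h'i : h' i = g := Function.update_self _ _ _
  have h'ne : ∀ a, a ≠ i → h' a = h a := fun a ha => Function.update_of_ne ha _ _
  have hm' : ∀ a, (h' a).Monic := by
    intro a
    by_cases ha : a = i
    · rw [ha, h'i]; exact hgm
    · rw [h'ne a ha]; exact hm a
  have hd' : ∀ a, (h' a).natDegree = d a := by
    intro a
    by_cases ha : a = i
    · rw [ha, h'i]; exact hgdeg
    · rw [h'ne a ha]; exact hdg a
  have hlt2 : ∑ a, (h a).natTrailingDegree < ∑ a, (h' a).natTrailingDegree := by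
    apply Finset.sum_lt_sum
    · intro a _
      by_cases ha : a = i
      · rw [ha, h'i, he]; omega
      · rw [h'ne a ha]
    · exact ⟨i, Finset.mem_univ _, by rw [h'i, he]; omega⟩
  have hle2 : ∑ a, (h' a).natTrailingDegree ≤ ∑ a, d a := by
    apply Finset.sum_le_sum
    intro a _
    rw [← hd' a]
    exact Polynomial.natTrailingDegree_le_natDegree _
  refine ih _ ?_ h' hm' hd' ?_ ?_ rfl
  · omega
  · rw [hh', hg, wron_update h i k hik, hw]
  · have hle : Submodule.span ℂ (Set.range h) ≤ Submodule.span ℂ (Set.range h') := by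
      rw [Submodule.span_le]
      rintro _ ⟨a, rfl⟩
      by_cases ha : a = i
      · have e1 : h a = h' i + c • h' k := by
          rw [h'i, h'ne k (fun h => hik h.symm), hg, ha, Polynomial.smul_eq_C_mul]; ring
        rw [e1]
        exact Submodule.add_mem _ (Submodule.subset_span ⟨i, rfl⟩)
          (Submodule.smul_mem _ _ (Submodule.subset_span ⟨k, rfl⟩))
      · rw [← h'ne a ha]
        exact Submodule.subset_span ⟨a, rfl⟩
    exact fun a => hle (hsp a)

theorem wron_zero {N : ℕ} (d : Fin N → ℕ) (hd : Function.Injective d)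
    (f : Fin N → Polynomial ℂ) (hm : ∀ i, (f i).Monic) (hdg : ∀ i, (f i).natDegree = d i)
    (hz : ∀ k < ∑ i, d i, (Polynomial.X ^ (∑ j : Fin N, (j : ℕ)) * wronR N f).coeff k = 0) :
    ∀ i m, m ∉ Set.range d → (f i).coeff m = 0 := by
  obtain ⟨h, hm', hd', hw, hsp, hinj⟩ := wron_reduce d hd f _ f hm hdg rfl
    (fun i => Submodule.subset_span ⟨i, rfl⟩) rfl
  have h1 := wron_low h _ hinj
    (fun i k hk => Polynomial.coeff_eq_zero_of_lt_natTrailingDegree hk)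
    (fun i => Polynomial.trailingCoeff_nonzero_iff_nonzero.2 (hm' i).ne_zero)
  rw [hw] at h1
  have h2 : ∑ i, d i ≤ ∑ i, (h i).natTrailingDegree := by
    by_contra hcon
    exact h1 (hz _ (not_le.1 hcon))
  have h3 : ∀ i ∈ Finset.univ, (h i).natTrailingDegree ≤ d i := fun i _ => by
    rw [← hd' i]
    exact Polynomial.natTrailingDegree_le_natDegree _
  have h4 := (Finset.sum_eq_sum_iff_of_le h3).1 (le_antisymm (Finset.sum_le_sum h3) h2)
  intro i m hmem
  have h5 : Submodule.span ℂ (Set.range h) ≤ LinearMap.ker (Polynomial.lcoeff ℂ m) := by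
    rw [Submodule.span_le]
    rintro _ ⟨a, rfl⟩
    show (h a).coeff m = 0
    rcases lt_trichotomy m (d a) with h6 | h6 | h6
    · exact Polynomial.coeff_eq_zero_of_lt_natTrailingDegree
        (by rw [h4 a (Finset.mem_univ _)]; exact h6)
    · exact absurd ⟨a, h6.symm⟩ hmem
    · exact Polynomial.coeff_eq_zero_of_natDegree_lt (by rw [hd' a]; exact h6)
  exact h5 (hsp i)

theorem wron_map {R S : Type*} [CommRing R] [CommRing S] (φ : R →+* S) (N : ℕ)
    (f : Fin N → Polynomial R) :
    (wronR N f).map φ = wronR N (fun i => (f i).map φ) := by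
  rw [wronR, wronR, ← Polynomial.coe_mapRingHom, RingHom.map_det]
  congr 1
  ext1 i j
  simp [Polynomial.iterate_derivative_map]

theorem sv_zero (N : ℕ) (d : Fin N → ℕ) (hd : Function.Injective d) (n : ℕ)
    (hsum : ∑ i, d i = n + ∑ j : Fin N, (j : ℕ)) (p : SchubertVar N d → ℂ)
    (hp : ∀ s : Fin n, MvPolynomial.eval p (SigmaEl N d n ((s : ℕ) + 1)) = 0) : p = 0 := by
  set f : Fin N → Polynomial ℂ := fun i => (genFun N d i).map (MvPolynomial.eval p) with hf
  have hcf : ∀ i m, (f i).coeff m = (if m = d i then 1 else 0) +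
      (if h : m < d i ∧ m ∉ Set.range d then
        p (mkV N d i (d i - m) (by
          refine ⟨by have := h.1; omega, Nat.sub_le _ _, ?_⟩
          have := h.1
          have e : d i - (d i - m) = m := by omega
          rw [e]; exact h.2)) else 0) := by
    intro i m
    rw [hf]
    simp only [Polynomial.coeff_map]
    rw [coeff_genFun, map_add]
    congr 1
    · split_ifs <;> simp
    · split_ifs <;> simp
  have hdg : ∀ i, (f i).natDegree ≤ d i := by
    intro i
    rw [Polynomial.natDegree_le_iff_coeff_eq_zero]
    intro m hm
    rw [hcf, if_neg (by omega), dif_neg (by omega), add_zero]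
  have hco : ∀ i, (f i).coeff (d i) = 1 := by
    intro i
    rw [hcf, if_pos rfl, dif_neg (by omega), add_zero]
  have hmon : ∀ i, (f i).Monic := fun i => Polynomial.monic_of_natDegree_le_of_coeff_eq_one _
    (hdg i) (hco i)
  have hdg' : ∀ i, (f i).natDegree = d i := fun i =>
    le_antisymm (hdg i) (Polynomial.le_natDegree_of_ne_zero (by rw [hco]; exact one_ne_zero))
  have hconst : (∏ i : Fin N, ∏ j ∈ Finset.Ioi i, ((d j : ℂ) - (d i : ℂ))) ≠ 0 := by
    refine Finset.prod_ne_zero_iff.2 fun i _ => Finset.prod_ne_zero_iff.2 fun j hj => ?_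
    rw [Finset.mem_Ioi] at hj
    rw [sub_ne_zero]
    intro h
    have : d j = d i := by exact_mod_cast h
    exact hj.ne' (hd this)
  have hwz : ∀ k < n, (wronR N f).coeff k = 0 := by
    intro k hk
    have h1 := hp ⟨n - k - 1, by omega⟩
    rw [SigmaEl, MvPolynomial.smul_eval] at h1
    have e : n - (n - k - 1 + 1) = k := by omega
    simp only [e] at h1
    rw [hf, ← wron_map, Polynomial.coeff_map]
    refine (mul_eq_zero.1 h1).resolve_left ?_
    exact mul_ne_zero (pow_ne_zero _ (by norm_num)) (inv_ne_zero hconst)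
  have hz := wron_zero d hd f hmon hdg' (by
    intro k hk
    rw [Polynomial.coeff_X_pow_mul']
    split_ifs with h
    · exact hwz _ (by omega)
    · rfl)
  funext v
  obtain ⟨⟨i, j⟩, hv⟩ := v
  obtain ⟨h1, h2, h3⟩ := hv
  dsimp only at h1 h2 h3
  have h4 := hz i (d i - j) h3
  rw [hcf, if_neg (by omega), dif_pos ⟨by omega, h3⟩, zero_add] at h4
  have e : d i - (d i - j) = j := by omega
  simp only [e] at h4
  exact h4

def svEquiv (N : ℕ) (d : Fin N → ℕ) :
    SchubertVar N d ≃ Σ i : Fin N, {k // k ∈ Finset.range (d i) \ Finset.univ.image d} where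
  toFun v := ⟨v.1.1, d v.1.1 - v.1.2, by
    have h := v.2
    rw [Finset.mem_sdiff, Finset.mem_range]
    refine ⟨by omega, ?_⟩
    intro hh
    rw [Finset.mem_image] at hh
    obtain ⟨a, _, ha⟩ := hh
    exact h.2.2 ⟨a, ha⟩⟩
  invFun x := mkV N d x.1 (d x.1 - x.2.1) (by
    have h := x.2.2
    rw [Finset.mem_sdiff, Finset.mem_range] at h
    refine ⟨by omega, by omega, ?_⟩
    have e : d x.1 - (d x.1 - x.2.1) = x.2.1 := by omega
    rw [e]
    rintro ⟨a, ha⟩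
    exact h.2 (Finset.mem_image.2 ⟨a, Finset.mem_univ _, ha⟩))
  left_inv v := by
    obtain ⟨⟨i, j⟩, h1, h2, h3⟩ := v
    dsimp only at h1 h2 h3
    have e : d i - (d i - j) = j := by omega
    simp only [e]
    rfl
  right_inv x := by
    obtain ⟨i, k, hk⟩ := x
    have h := hk
    rw [Finset.mem_sdiff, Finset.mem_range] at h
    have e : d i - (d i - k) = k := by omega
    simp only [mkV, e]

theorem sv_count (N : ℕ) (d lam : Fin N → ℕ) (hanti : StrictAnti d)
    (hd : ∀ i : Fin N, d i = lam i + (N - 1 - (i : ℕ))) (i : Fin N) :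
    (Finset.range (d i) \ Finset.univ.image d).card = lam i := by
  have h1 : Finset.range (d i) ∩ Finset.univ.image d = (Finset.Ioi i).image d := by
    ext k
    simp only [Finset.mem_inter, Finset.mem_range, Finset.mem_image, Finset.mem_univ, true_and,
      Finset.mem_Ioi]
    constructor
    · rintro ⟨h, a, rfl⟩
      exact ⟨a, hanti.lt_iff_gt.1 h, rfl⟩
    · rintro ⟨a, ha, rfl⟩
      exact ⟨hanti ha, a, rfl⟩
  have h2 := Finset.card_sdiff_add_card_inter (Finset.range (d i)) (Finset.univ.image d)
  rw [h1, Finset.card_image_of_injective _ hanti.injective, Fin.card_Ioi, Finset.card_range,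
    hd i] at h2
  rw [hd i]
  omega

theorem stmt_17 (N : ℕ) (hN : 1 ≤ N)
    (lam : Fin N → ℕ) (hlam : Antitone lam)
    (d : Fin N → ℕ) (hd : ∀ i : Fin N, d i = lam i + (N - 1 - (i : ℕ)))
    (n : ℕ) (hn : n = ∑ i, lam i) :
    (∀ a : Fin n → ℂ,
      FiniteDimensional ℂ (SchubertAlg N d ⧸ wronskiIdeal N d n a) ∧
      ∃ b : (SchubertAlg N d ⧸ wronskiIdeal N d n a) →ₗ[ℂ]
          (SchubertAlg N d ⧸ wronskiIdeal N d n a) →ₗ[ℂ] ℂ,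
        (∀ x y, b x y = b y x) ∧
        (∀ x y z, b (x * y) z = b x (y * z)) ∧
        (∀ x, (∀ y, b x y = 0) → x = 0)) ∧
    ∀ a a' : Fin n → ℂ,
      Module.finrank ℂ (SchubertAlg N d ⧸ wronskiIdeal N d n a) =
        Module.finrank ℂ (SchubertAlg N d ⧸ wronskiIdeal N d n a') := by
  have hanti : StrictAnti d := by
    intro i j hij
    have h1 := hlam hij.le
    have h2 : (i : ℕ) < j := hij
    have h3 := j.2
    rw [hd, hd]
    omega
  have hsum : ∑ i, d i = n + ∑ j : Fin N, (j : ℕ) := by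
    rw [hn, Finset.sum_congr rfl (fun i _ => hd i), Finset.sum_add_distrib]
    congr 1
    rw [← Equiv.sum_comp Fin.revPerm]
    refine Finset.sum_congr rfl fun i _ => ?_
    have := i.2
    simp only [Fin.revPerm_apply, Fin.val_rev]
    omega
  let _ : Fintype (SchubertVar N d) := Fintype.ofEquiv _ (svEquiv N d).symm
  have hcard : Fintype.card (SchubertVar N d) = n := by
    rw [Fintype.card_congr (svEquiv N d), Fintype.card_sigma, hn]
    refine Finset.sum_congr rfl fun i _ => ?_
    rw [Fintype.card_coe]
    exact sv_count N d lam hanti hd i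
  have e : SchubertVar N d ≃ Fin n := Fintype.equivFinOfCardEq hcard
  exact fib2 e (fun s : Fin n => SigmaEl N d n ((s : ℕ) + 1))
    (graded_int (svWt N d) (fun s : Fin n => (s : ℕ) + 1) (fun s => Nat.succ_pos _) _
      (fun s => sigma_hom N d n _ s.2 hsum)
      (fun p hp => sv_zero N d hanti.injective n hsum p hp))
    (wronskiIdeal N d n) (fun a => rfl)
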